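/- arXiv:2404.12303 — 6 statements merged into one kernel-verified Lean document; each statement's English description precedes it below -/
import Mathlib

section
/- Let R be a commutative ring, let r ≥ 1, and let x_1,…,x_r and z_1,…,z_r be elements of R. Then ∏_{i=1}^r ∏_{l<i} (z_i − z_l)(x_l − x_i) = ∑_{σ ∈ S_r} sgn(σ) ∏_{l=1}^r ∏_{j ∈ {1,…,r}, j ≠ σ(l)} (x_j − z_l), where S_r is the symmetric group on {1,…,r} and sgn(σ) is the sign of the permutation σ. -/
open Polynomial in
theorem aux_factor {R : Type*} [CommRing R] [Nontrivial R] (r : ℕ) (x z : Fin r → R) :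
    Matrix.of (fun l k : Fin r => ∏ j ∈ Finset.univ.erase k, (x j - z l)) =
      Matrix.vandermonde z * Matrix.of (fun i k : Fin r =>
        (∏ j ∈ Finset.univ.erase k, (C (x j) - X) : R[X]).coeff i) := by
  ext l k
  have hr : 0 < r := l.pos
  have hdeg : (∏ j ∈ Finset.univ.erase k, (C (x j) - X) : R[X]).natDegree < r := by
    refine lt_of_le_of_lt (natDegree_prod_le _ _) ?_
    refine lt_of_le_of_lt (Finset.sum_le_card_nsmul _ _ 1 ?_) ?_
    · intro j _
      refine (natDegree_sub_le _ _).trans ?_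
      simp
    · simp [Finset.card_erase_of_mem]
      omega
  have h := eval_eq_sum_range' hdeg (z l)
  rw [eval_prod, ← Fin.sum_univ_eq_sum_range (fun i => coeff _ i * z l ^ i)] at h
  simp only [eval_sub, eval_C, eval_X] at h
  simp only [Matrix.of_apply, Matrix.mul_apply, Matrix.vandermonde_apply]
  rw [h]
  exact Finset.sum_congr rfl fun i _ => mul_comm _ _

theorem aux_swap {R : Type*} [CommRing R] (r : ℕ) (f : Fin r → Fin r → R) :
    ∏ i, ∏ l ∈ Finset.Iio i, f i l = ∏ l, ∏ i ∈ Finset.Ioi l, f i l :=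
  Finset.prod_comm' (by simp)

theorem aux_offdiag {R : Type*} [CommRing R] (r : ℕ) (x : Fin r → R) :
    ∏ k, ∏ j ∈ Finset.univ.erase k, (x j - x k) =
      (∏ i, ∏ l ∈ Finset.Ioi i, (x l - x i)) * ∏ i, ∏ l ∈ Finset.Iio i, (x l - x i) := by
  rw [← Finset.prod_mul_distrib]
  refine Finset.prod_congr rfl fun k _ => ?_
  rw [← Finset.prod_union]
  · refine Finset.prod_congr ?_ fun _ _ => rfl
    ext j
    simp only [Finset.mem_erase, Finset.mem_univ, Finset.mem_union, Finset.mem_Ioi,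
      Finset.mem_Iio, and_true]
    rw [ne_iff_lt_or_gt]
    exact or_comm
  · rw [Finset.disjoint_left]
    intro a ha hb
    simp only [Finset.mem_Ioi, Finset.mem_Iio] at ha hb
    exact lt_asymm ha hb

theorem aux_domain {R : Type*} [CommRing R] [IsDomain R] (r : ℕ) (x z : Fin r → R)
    (hx : Function.Injective x) :
    ∏ i : Fin r, ∏ l ∈ Finset.Iio i, ((z i - z l) * (x l - x i)) =
      ∑ σ : Equiv.Perm (Fin r),
        ((Equiv.Perm.sign σ : ℤ) : R) *
          ∏ l : Fin r, ∏ j ∈ Finset.univ.erase (σ l), (x j - z l) := by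
  have h1 := congrArg Matrix.det (aux_factor r x z)
  have h2 := congrArg Matrix.det (aux_factor r x x)
  have hd : Matrix.of (fun l k : Fin r => ∏ j ∈ Finset.univ.erase k, (x j - x l)) =
      Matrix.diagonal (fun k => ∏ j ∈ Finset.univ.erase k, (x j - x k)) := by
    ext l k
    by_cases h : l = k
    · subst h; simp
    · rw [Matrix.diagonal_apply_ne _ h, Matrix.of_apply]
      exact Finset.prod_eq_zero (i := l) (by simp [h]) (sub_self _)
  rw [Matrix.det_mul] at h1 h2
  rw [hd, Matrix.det_diagonal, aux_offdiag, ← Matrix.det_vandermonde] at h2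
  have h3 := mul_left_cancel₀ (Matrix.det_vandermonde_ne_zero_iff.mpr hx) h2
  rw [← h3, ← Matrix.det_transpose, Matrix.det_apply', Matrix.det_vandermonde] at h1
  simp only [Matrix.transpose_apply, Matrix.of_apply] at h1
  rw [h1, ← aux_swap r (fun i l => z i - z l)]
  simp only [Finset.prod_mul_distrib]

/-- Lemma 5.2: identity of (bi-)anti-symmetric functions. -/
theorem stmt_0 (R : Type*) [CommRing R] (r : ℕ) (hr : 1 ≤ r) (x z : Fin r → R) :
    ∏ i : Fin r, ∏ l ∈ Finset.Iio i, ((z i - z l) * (x l - x i)) =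
      ∑ σ : Equiv.Perm (Fin r),
        ((Equiv.Perm.sign σ : ℤ) : R) *
          ∏ l : Fin r, ∏ j ∈ Finset.univ.erase (σ l), (x j - z l) := by
  have h := aux_domain (R := MvPolynomial (Fin r ⊕ Fin r) ℤ) r
    (fun i => MvPolynomial.X (Sum.inl i)) (fun i => MvPolynomial.X (Sum.inr i))
    (fun i j hij => Sum.inl_injective (MvPolynomial.X_injective hij))
  have h' := congrArg (MvPolynomial.eval₂Hom (Int.castRingHom R) (Sum.elim x z)) h
  simpa only [map_prod, map_sum, map_mul, map_sub, map_intCast, MvPolynomial.eval₂Hom_X',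
    Sum.elim_inl, Sum.elim_inr] using h'
end

section
/- Fix r ≥ 1 and work in the polynomial ring ℤ[X_1,…,X_r,Z_1,…,Z_r]. Let R(X,Z) = ∑_{σ ∈ S_r} sgn(σ) ∏_{l=1}^r ∏_{j ∈ {1,…,r}, j ≠ σ(l)} (X_j − Z_l). Then for every pair of distinct indices i ≠ l in {1,…,r}, the polynomial (X_i − X_l) divides R(X,Z). -/
/-- Divisibility of R(X,Z) by (X_i - X_l), from the proof of Lemma 5.2. -/
theorem stmt_3 (r : ℕ) (hr : 1 ≤ r) (i l : Fin r) (hil : i ≠ l) :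
    (MvPolynomial.X (Sum.inl i) - MvPolynomial.X (Sum.inl l) :
        MvPolynomial (Fin r ⊕ Fin r) ℤ) ∣
      ∑ σ : Equiv.Perm (Fin r),
        ((Equiv.Perm.sign σ : ℤ) : MvPolynomial (Fin r ⊕ Fin r) ℤ) *
          ∏ l' : Fin r, ∏ j ∈ Finset.univ.erase (σ l'),
            (MvPolynomial.X (Sum.inl j) - MvPolynomial.X (Sum.inr l')) := by
  have hdet := Matrix.det_apply' (Matrix.of fun (a b : Fin r) =>
    ∏ j ∈ Finset.univ.erase a,
      (MvPolynomial.X (Sum.inl j) - MvPolynomial.X (Sum.inr b) :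
        MvPolynomial (Fin r ⊕ Fin r) ℤ))
  simp only [Matrix.of_apply] at hdet
  rw [← hdet, ← Ideal.Quotient.eq_zero_iff_dvd, RingHom.map_det]
  refine Matrix.det_zero_of_row_eq hil ?_
  funext b
  simp only [RingHom.mapMatrix_apply, Matrix.map_apply, Matrix.of_apply, map_prod]
  have hi : l ∈ (Finset.univ : Finset (Fin r)).erase i := by simp [hil.symm]
  have hl : i ∈ (Finset.univ : Finset (Fin r)).erase l := by simp [hil]
  rw [← Finset.mul_prod_erase _ _ hi, ← Finset.mul_prod_erase _ _ hl,
    Finset.erase_right_comm]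
  congr 1
  rw [Ideal.Quotient.eq, Ideal.mem_span_singleton]
  exact ⟨-1, by ring⟩
end

section
/- Fix r ≥ 1 and work in the polynomial ring ℤ[X_1,…,X_r,Z_1,…,Z_r]. For any permutation σ of {1,…,r} with σ ≠ id, the coefficient of the monomial ∏_{i=1}^r X_i^{i−1} Z_i^{i−1} in the polynomial ∏_{l=1}^r ∏_{j ∈ {1,…,r}, j ≠ σ(l)} (X_j − Z_l) equals 0; that is, this monomial appears only in the summand of ∑_{σ ∈ S_r} sgn(σ) ∏_{l=1}^r ∏_{j ≠ σ(l)} (X_j − Z_l) indexed by σ = id. -/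
open Finset in
lemma aux_coeff {ι τ : Type*} [DecidableEq ι] (s : Finset ι) (a b : ι → τ) (m : τ →₀ ℕ)
    (h : MvPolynomial.coeff m (∏ p ∈ s,
      (MvPolynomial.X (a p) - MvPolynomial.X (b p) : MvPolynomial τ ℤ)) ≠ 0) :
    ∃ t ⊆ s, m = ∑ p ∈ t, Finsupp.single (a p) 1 + ∑ p ∈ s \ t, Finsupp.single (b p) 1 := by
  induction s using Finset.induction_on generalizing m with
  | empty =>
    refine ⟨∅, Finset.Subset.refl _, ?_⟩
    classical
    rw [Finset.prod_empty, MvPolynomial.coeff_one] at h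
    by_contra h2
    apply h
    rw [if_neg]
    intro h3
    apply h2
    simp [← h3]
  | insert q s hq ih =>
    classical
    rw [Finset.prod_insert hq, sub_mul, MvPolynomial.coeff_sub,
      MvPolynomial.coeff_X_mul', MvPolynomial.coeff_X_mul'] at h
    have hle : ∀ x, x ∈ m.support → m = Finsupp.single x 1 + (m - Finsupp.single x 1) := by
      intro x hx
      rw [add_tsub_cancel_of_le]
      rw [Finsupp.single_le_iff]
      have := Finsupp.mem_support_iff.1 hx
      omega
    by_cases h1 : (if a q ∈ m.support then MvPolynomial.coeff (m - Finsupp.single (a q) 1)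
        (∏ p ∈ s, (MvPolynomial.X (a p) - MvPolynomial.X (b p) : MvPolynomial τ ℤ)) else 0) = 0
    · rw [h1, zero_sub, neg_ne_zero] at h
      obtain ⟨hx, h⟩ := ite_ne_right_iff.1 h
      obtain ⟨t, ht, e⟩ := ih _ h
      refine ⟨t, ht.trans (subset_insert _ _), ?_⟩
      have hqt : q ∉ t := fun h => hq (ht h)
      rw [insert_sdiff_of_notMem _ hqt, sum_insert (by simp [hq]), hle _ hx, e]
      abel
    · obtain ⟨hx, h⟩ := ite_ne_right_iff.1 h1
      obtain ⟨t, ht, e⟩ := ih _ h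
      have hqt : q ∉ t := fun h => hq (ht h)
      refine ⟨insert q t, insert_subset_insert _ ht, ?_⟩
      rw [insert_sdiff_insert, sdiff_insert_of_notMem hq, sum_insert hqt, hle _ hx, e]
      abel

open Finset in
lemma aux_comb (r : ℕ) (σ : Equiv.Perm (Fin r)) (s t : Finset (Fin r × Fin r))
    (hs : ∀ p, p ∈ s ↔ p.2 ≠ σ p.1)
    (hc : ∀ j : Fin r, #{p ∈ t | p.2 = j} = (j : ℕ))
    (hr : ∀ l : Fin r, #{p ∈ s \ t | p.1 = l} = (l : ℕ)) (hts : t ⊆ s) (i : Fin r) :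
    σ i = i ∧ (∀ j, (i, j) ∈ s → (i, j) ∉ t → j < i) ∧ (∀ l, (l, i) ∈ t → l < i) := by
  induction i using WellFoundedLT.induction with
  | ind i ih =>
    have A : (Iio i).image (fun j => (i, j)) = {p ∈ s \ t | p.1 = i} := by
      apply eq_of_subset_of_card_le
      · intro p hp
        obtain ⟨j, hj, rfl⟩ := mem_image.1 hp
        have hj := mem_Iio.1 hj
        obtain ⟨h1, h2, h3⟩ := ih j hj
        simp only [mem_filter, mem_sdiff, and_true, hs]
        refine ⟨fun h => ?_, fun h => absurd (h3 i h) hj.not_gt⟩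
        exact hj.ne (σ.injective (h1.trans h))
      · rw [hr, card_image_of_injective _ (fun x y h => (Prod.ext_iff.1 h).2)]
        simp
    have B : (Iio i).image (fun j => (j, i)) = {p ∈ t | p.2 = i} := by
      apply eq_of_subset_of_card_le
      · intro p hp
        obtain ⟨j, hj, rfl⟩ := mem_image.1 hp
        have hj := mem_Iio.1 hj
        obtain ⟨h1, h2, h3⟩ := ih j hj
        simp only [mem_filter, and_true]
        by_contra h
        refine absurd (h2 i ?_ h) hj.not_gt
        rw [hs]
        simpa [h1] using hj.ne'
      · rw [hc, card_image_of_injective _ (fun x y h => (Prod.ext_iff.1 h).1)]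
        simp
    have A' : ∀ j, (i, j) ∈ s → (i, j) ∉ t → j < i := by
      intro j h1 h2
      have : (i, j) ∈ ({p ∈ s \ t | p.1 = i} : Finset _) := by simp [h1, h2]
      rw [← A] at this
      simpa using this
    have B' : ∀ l, (l, i) ∈ t → l < i := by
      intro j h1
      have : (j, i) ∈ ({p ∈ t | p.2 = i} : Finset _) := by simp [h1]
      rw [← B] at this
      simpa using this
    refine ⟨?_, A', B'⟩
    by_contra h
    have hi : (i, i) ∈ s := (hs _).2 (Ne.symm h)
    by_cases ht : (i, i) ∈ t
    · exact lt_irrefl _ (B' i ht)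
    · exact lt_irrefl _ (A' i hi ht)

/-- Only the identity permutation contributes the monomial ∏ X_i^{i-1} Z_i^{i-1}. -/
theorem stmt_5 (r : ℕ) (hr : 1 ≤ r) (σ : Equiv.Perm (Fin r)) (hσ : σ ≠ 1) :
    MvPolynomial.coeff
      (Finsupp.equivFunOnFinite.symm
        (Sum.elim (fun i : Fin r => (i : ℕ)) (fun i : Fin r => (i : ℕ))))
      (∏ l : Fin r, ∏ j ∈ Finset.univ.erase (σ l),
        (MvPolynomial.X (Sum.inl j) - MvPolynomial.X (Sum.inr l) :
          MvPolynomial (Fin r ⊕ Fin r) ℤ)) = 0 := by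
  by_contra h
  have hs : ∀ p : Fin r × Fin r,
      p ∈ (Finset.univ.filter fun p : Fin r × Fin r => p.2 ≠ σ p.1) ↔ p.2 ≠ σ p.1 := by simp
  rw [← Finset.prod_finset_product' (Finset.univ.filter fun p : Fin r × Fin r => p.2 ≠ σ p.1)
    Finset.univ (fun l => Finset.univ.erase (σ l)) (by simp)] at h
  obtain ⟨t, ht, e⟩ := aux_coeff _ (fun p : Fin r × Fin r => (Sum.inl p.2 : Fin r ⊕ Fin r))
    (fun p => Sum.inr p.1) _ h
  apply hσ
  ext i
  have hc := aux_comb r σ _ t hs ?_ ?_ ht i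
  · rw [hc.1]; rfl
  · intro j
    have := DFunLike.congr_fun e (Sum.inl j)
    rw [Finset.card_filter]
    simpa [Finsupp.finsetSum_apply, Finsupp.single_apply, -Finset.sum_boole] using this.symm
  · intro j
    have := DFunLike.congr_fun e (Sum.inr j)
    rw [Finset.card_filter]
    simpa [Finsupp.finsetSum_apply, Finsupp.single_apply, -Finset.sum_boole] using this.symm
end

section
/- Let r ≥ 1 and let x_1,…,x_r and z_1,…,z_r be complex numbers. Then ∑_{σ ∈ S_r} sgn(σ) ∏_{k=1}^r ∏_{j ∈ {1,…,r}, j ≠ σ(k)} sin((x_k − z_j)/(2i)) = ∏_{k=1}^r ∏_{l<k} sin((z_l − z_k)/(2i)) · sin((x_k − x_l)/(2i)), where i = √−1 and sin denotes the complex sine function. -/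
theorem aux_split {M : Type*} [CommMonoid M] (r : ℕ) (f : Fin r → Fin r → M) :
    ∏ k, ∏ l ∈ Finset.univ.erase k, f k l = ∏ k, ∏ l ∈ Finset.Iio k, (f k l * f l k) := by
  have h1 : ∀ k : Fin r, (Finset.univ.erase k) = (Finset.Iio k).disjUnion (Finset.Ioi k)
      (by
        rw [Finset.disjoint_left]
        intro a h h'
        simp only [Finset.mem_Iio, Finset.mem_Ioi] at h h'
        exact absurd h (not_lt.mpr h'.le)) := by
    intro k
    ext a
    simp [lt_or_lt_iff_ne]
  simp_rw [Finset.prod_mul_distrib]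
  rw [Finset.prod_comm' (s := Finset.univ) (t := fun k => Finset.Iio k)
    (t' := Finset.univ) (s' := fun k => Finset.Ioi k) (f := fun k l => f l k) (by simp),
    ← Finset.prod_mul_distrib]
  refine Finset.prod_congr rfl fun k _ => ?_
  rw [h1 k, Finset.prod_disjUnion]

theorem aux_cauchy {F : Type*} [Field F] (r : ℕ) (x z : Fin r → F) :
    (Matrix.of fun k j : Fin r => ∏ l ∈ Finset.univ.erase j, (x k - z l)).det =
      ∏ k, ∏ l ∈ Finset.Iio k, ((z l - z k) * (x k - x l)) := by
  have hV : ∀ v : Fin r → F, (Matrix.vandermonde v).det =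
      ∏ k, ∏ l ∈ Finset.Iio k, (v k - v l) := by
    intro v
    rw [Matrix.det_vandermonde]
    exact Finset.prod_comm' (by simp)
  by_cases hz : Function.Injective z
  · let P : Fin r → Polynomial F := fun j =>
      ∏ l ∈ Finset.univ.erase j, (Polynomial.X - Polynomial.C (z l))
    let C : Matrix (Fin r) (Fin r) F := Matrix.of fun i j => (P j).coeff i
    have hdeg : ∀ j, (P j).natDegree < r := by
      intro j
      have : (P j).natDegree = r - 1 := by
        simp [P, Polynomial.natDegree_finsetProd_X_sub_C_eq_card]
      have := j.pos
      omega
    have hM : ∀ v : Fin r → F,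
        (Matrix.of fun k j : Fin r => ∏ l ∈ Finset.univ.erase j, (v k - z l)) =
          Matrix.vandermonde v * C := by
      intro v
      ext k j
      have : (P j).eval (v k) = ∏ l ∈ Finset.univ.erase j, (v k - z l) := by
        simp [P, Polynomial.eval_prod]
      rw [Matrix.of_apply, ← this, Polynomial.eval_eq_sum_range' (hdeg j),
        Matrix.mul_apply, ← Fin.sum_univ_eq_sum_range (fun i => (P j).coeff i * v k ^ i)]
      refine Finset.sum_congr rfl fun i _ => ?_
      simp [C, Matrix.vandermonde_apply, mul_comm]
    have hd : (Matrix.of fun k j : Fin r => ∏ l ∈ Finset.univ.erase j, (z k - z l)).det =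
        ∏ k, ∏ l ∈ Finset.univ.erase k, (z k - z l) := by
      have : (Matrix.of fun k j : Fin r => ∏ l ∈ Finset.univ.erase j, (z k - z l)) =
          Matrix.diagonal fun k => ∏ l ∈ Finset.univ.erase k, (z k - z l) := by
        ext k j
        by_cases h : k = j
        · subst h; simp
        · rw [Matrix.diagonal_apply_ne _ h, Matrix.of_apply]
          exact Finset.prod_eq_zero (i := k) (by simp [h]) (sub_self _)
      rw [this, Matrix.det_diagonal]
    have hne : (Matrix.vandermonde z).det ≠ 0 := Matrix.det_vandermonde_ne_zero_iff.mpr hz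
    rw [hM z, Matrix.det_mul, aux_split] at hd
    simp_rw [Finset.prod_mul_distrib] at hd ⊢
    rw [← hV z] at hd
    rw [hM x, Matrix.det_mul, mul_left_cancel₀ hne hd, hV x, mul_comm]
  · have hz' := hz
    simp only [Function.Injective, not_forall] at hz
    obtain ⟨a, b, hab, hne⟩ := hz
    have h0 : ∏ k, ∏ l ∈ Finset.Iio k, (z l - z k) = 0 := by
      rcases lt_or_gt_of_ne hne with h | h
      · exact Finset.prod_eq_zero (Finset.mem_univ b)
          (Finset.prod_eq_zero (i := a) (by simpa using h) (by simp [hab]))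
      · exact Finset.prod_eq_zero (Finset.mem_univ a)
          (Finset.prod_eq_zero (i := b) (by simpa using h) (by simp [hab]))
    simp_rw [Finset.prod_mul_distrib]
    rw [h0, zero_mul]
    refine Matrix.det_zero_of_column_eq hne fun k => ?_
    simp only [Matrix.of_apply]
    rw [← Finset.mul_prod_erase (Finset.univ.erase a) _ (a := b) (by simp [Ne.symm hne]),
      ← Finset.mul_prod_erase (Finset.univ.erase b) _ (a := a) (by simp [hne]),
      Finset.erase_right_comm, hab]

/-- Equation (e:sym4): the sine identity. -/
theorem stmt_7 (r : ℕ) (hr : 1 ≤ r) (x z : Fin r → ℂ) :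
    ∑ σ : Equiv.Perm (Fin r),
        ((Equiv.Perm.sign σ : ℤ) : ℂ) *
          ∏ k : Fin r, ∏ j ∈ Finset.univ.erase (σ k),
            Complex.sin ((x k - z j) / (2 * Complex.I)) =
      ∏ k : Fin r, ∏ l ∈ Finset.Iio k,
        (Complex.sin ((z l - z k) / (2 * Complex.I)) *
          Complex.sin ((x k - x l) / (2 * Complex.I))) := by
  have hs : ∀ u v : ℂ, Complex.sin ((u - v) / (2 * Complex.I)) =
      ((-Complex.I / 2) * Complex.exp (-u / 2)) * Complex.exp (-v / 2) *
        (Complex.exp u - Complex.exp v) := by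
    intro u v
    have h1 : (u - v) / (2 * Complex.I) * Complex.I = (u - v) / 2 := by
      field_simp
    have h2 : -((u - v) / (2 * Complex.I)) * Complex.I = -v / 2 * (-1) + -u / 2 := by
      rw [neg_mul, h1]; ring
    rw [Complex.sin, h1, h2]
    have e1 : Complex.exp (-u / 2) * Complex.exp (-v / 2) * Complex.exp u
        = Complex.exp ((u - v) / 2) := by
      rw [← Complex.exp_add, ← Complex.exp_add]; congr 1; ring
    have e2 : Complex.exp (-u / 2) * Complex.exp (-v / 2) * Complex.exp v
        = Complex.exp (-v / 2 * (-1) + -u / 2) := by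
      rw [← Complex.exp_add, ← Complex.exp_add]; congr 1; ring
    rw [← e1, ← e2]; ring
  let h : Fin r → ℂ := fun k => (-Complex.I / 2) * Complex.exp (-x k / 2)
  let b : Fin r → ℂ := fun k => Complex.exp (-z k / 2)
  have hc := aux_cauchy r (fun k => Complex.exp (x k)) (fun k => Complex.exp (z k))
  rw [← Matrix.det_transpose, Matrix.det_apply'] at hc
  simp only [Matrix.transpose_apply, Matrix.of_apply] at hc
  have hR : ∏ k : Fin r, ∏ l ∈ Finset.Iio k,
        (Complex.sin ((z l - z k) / (2 * Complex.I)) *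
          Complex.sin ((x k - x l) / (2 * Complex.I))) =
      (∏ k, ∏ l ∈ Finset.univ.erase k, h k * b l) *
      ∏ k : Fin r, ∏ l ∈ Finset.Iio k, ((Complex.exp (z l) - Complex.exp (z k)) *
        (Complex.exp (x k) - Complex.exp (x l))) := by
    rw [aux_split]
    simp_rw [← Finset.prod_mul_distrib]
    refine Finset.prod_congr rfl fun k _ => Finset.prod_congr rfl fun l _ => ?_
    rw [hs, hs]
    simp only [h, b]
    ring
  rw [hR, ← hc, Finset.mul_sum]
  refine Finset.sum_congr rfl fun σ _ => ?_
  have hL : ∏ k, ∏ l ∈ Finset.univ.erase k, h k * b l =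
      ∏ k, ∏ l ∈ Finset.univ.erase (σ k), h k * b l := by
    simp_rw [Finset.prod_mul_distrib]
    congr 1
    · simp
    · exact (Equiv.prod_comp σ (fun k => ∏ l ∈ Finset.univ.erase k, b l)).symm
  rw [hL, mul_left_comm, ← Finset.prod_mul_distrib]
  congr 1
  refine Finset.prod_congr rfl fun k _ => ?_
  rw [← Finset.prod_mul_distrib]
  refine Finset.prod_congr rfl fun l _ => ?_
  rw [hs]
end

section
/- Let r ≥ 1 and let x_1,…,x_r and z_1,…,z_r be complex numbers such that sin((z_j − z_k)/(2i)) ≠ 0 for all j ≠ k in {1,…,r} and sin((x_j − x_k)/(2i)) ≠ 0 for all j ≠ k in {1,…,r}. Then ∑_{σ ∈ S_r} ∏_{k=1}^r [ ( ∏_{j ∈ {1,…,r}, j ≠ σ(k)} sin((x_k − z_j)/(2i)) / sin((z_{σ(k)} − z_j)/(2i)) ) · ∏_{l<k} sin((z_{σ(k)} − z_{σ(l)})/(2i)) / sin((x_k − x_l)/(2i)) ] = 1. -/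
lemma sin_half_exp (a b : ℂ) : Complex.sin ((a - b) / (2 * Complex.I)) =
    (Complex.exp (a / 2) * Complex.exp (-b / 2) - Complex.exp (b / 2) * Complex.exp (-a / 2)) *
      (-Complex.I / 2) := by
  have h1 : (a - b) / (2 * Complex.I) * Complex.I = (a - b) / 2 := by
    have := Complex.I_ne_zero
    field_simp
  have h2 : -((a - b) / (2 * Complex.I)) * Complex.I = (b - a) / 2 := by
    rw [neg_mul, h1]; ring
  rw [Complex.sin, h1, h2, ← Complex.exp_add, ← Complex.exp_add]
  rw [show (b - a) / 2 = b / 2 + -a / 2 by ring, show (a - b) / 2 = a / 2 + -b / 2 by ring]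
  ring

/-- Lagrange interpolation in homogeneous form. -/
lemma lagrange_homog {r : ℕ} (v w : Fin r → ℂ) (hw : ∀ i, w i ≠ 0)
    (hvw : ∀ i j, i ≠ j → v i * w j - v j * w i ≠ 0) (a b : ℂ) (hb : b ≠ 0) (p : Fin r) :
    a ^ p.1 * b ^ p.rev.1 = ∑ i, (∏ j ∈ Finset.univ.erase i,
      (a * w j - v j * b) / (v i * w j - v j * w i)) * (v i ^ p.1 * w i ^ p.rev.1) := by
  have hinj : Set.InjOn (fun i => v i / w i) (Finset.univ : Finset (Fin r)) := by
    intro i _ j _ hij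
    by_contra hne
    apply hvw i j hne
    have := hw i
    have := hw j
    simp only at hij
    field_simp at hij
    linear_combination hij
  have h := Lagrange.eq_interpolate (f := (Polynomial.X ^ p.1 : Polynomial ℂ)) hinj (by
    simp)
  have h2 := congrArg (Polynomial.eval (a / b)) h
  rw [Lagrange.interpolate_apply, Polynomial.eval_finsetSum] at h2
  simp only [Polynomial.eval_pow, Polynomial.eval_X, Polynomial.eval_mul, Polynomial.eval_C,
    Lagrange.basis, Polynomial.eval_prod, Lagrange.basisDivisor, Polynomial.eval_sub] at h2
  have hp : p.1 + p.rev.1 = r - 1 := by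
    rw [Fin.val_rev]; omega
  have key : ∀ c d : ℂ, d ≠ 0 → c ^ p.1 * d ^ p.rev.1 = d ^ (r - 1) * (c / d) ^ p.1 := by
    intro c d hd
    rw [← hp, pow_add, div_pow]
    field_simp
  rw [key a b hb, h2, Finset.mul_sum]
  refine Finset.sum_congr rfl fun i _ => ?_
  rw [key _ _ (hw i)]
  have hc : (Finset.univ.erase i : Finset (Fin r)).card = r - 1 := by simp
  have : ∏ j ∈ Finset.univ.erase i, (a * w j - v j * b) / (v i * w j - v j * w i) =
      (b / w i) ^ (r - 1) *
        ∏ j ∈ Finset.univ.erase i, ((v i / w i - v j / w j)⁻¹ * (a / b - v j / w j)) := by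
    rw [← hc, ← Finset.prod_const, ← Finset.prod_mul_distrib]
    refine Finset.prod_congr rfl fun j hj => ?_
    have hne := hvw i j (Finset.ne_of_mem_erase hj).symm
    have h1 := hw i
    have h2 := hw j
    have e1 : v i / w i - v j / w j = (v i * w j - v j * w i) / (w i * w j) := by
      field_simp
    have e2 : a / b - v j / w j = (a * w j - v j * b) / (b * w j) := by
      field_simp
    rw [e1, e2]
    field_simp
  rw [this, div_pow b]
  have h1 := pow_ne_zero (r - 1) (hw i)
  generalize (∏ j ∈ Finset.univ.erase i, ((v i / w i - v j / w j)⁻¹ * (a / b - v j / w j))) = Q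
  generalize w i ^ (r - 1) = R at *
  generalize (v i / w i) ^ p.1 = T
  generalize b ^ (r - 1) = U
  field_simp

/-- Equation (e:sym3): the sum over permutations of sine-ratio products equals 1. -/
theorem stmt_8 (r : ℕ) (hr : 1 ≤ r) (x z : Fin r → ℂ)
    (hz : ∀ j k : Fin r, j ≠ k → Complex.sin ((z j - z k) / (2 * Complex.I)) ≠ 0)
    (hx : ∀ j k : Fin r, j ≠ k → Complex.sin ((x j - x k) / (2 * Complex.I)) ≠ 0) :
    ∑ σ : Equiv.Perm (Fin r),
      ∏ k : Fin r,
        ((∏ j ∈ Finset.univ.erase (σ k),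
            Complex.sin ((x k - z j) / (2 * Complex.I)) /
              Complex.sin ((z (σ k) - z j) / (2 * Complex.I))) *
          ∏ l ∈ Finset.Iio k,
            Complex.sin ((z (σ k) - z (σ l)) / (2 * Complex.I)) /
              Complex.sin ((x k - x l) / (2 * Complex.I))) = 1 := by
  have hc : (-Complex.I / 2 : ℂ) ≠ 0 := by simp
  set c : ℂ := -Complex.I / 2 with hcdef
  let V : (Fin r → ℂ) → Fin r → ℂ := fun y i => Complex.exp (y i / 2)
  let W : (Fin r → ℂ) → Fin r → ℂ := fun y i => Complex.exp (-y i / 2)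
  let P : (Fin r → ℂ) → ℂ := fun y => ∏ k : Fin r, ∏ l ∈ Finset.Iio k,
    Complex.sin ((y k - y l) / (2 * Complex.I))
  let N : Matrix (Fin r) (Fin r) ℂ := Matrix.of fun i k => ∏ j ∈ Finset.univ.erase i,
    Complex.sin ((x k - z j) / (2 * Complex.I)) / Complex.sin ((z i - z j) / (2 * Complex.I))
  have hP : ∀ y, P y = (Matrix.projVandermonde (V y) (W y)).det *
      ∏ k : Fin r, ∏ _l ∈ Finset.Iio k, c := by
    intro y
    rw [Matrix.det_projVandermonde, Finset.prod_comm' (s' := Finset.Iio) (t' := Finset.univ)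
      (by simp), ← Finset.prod_mul_distrib]
    refine Finset.prod_congr rfl fun k _ => ?_
    rw [← Finset.prod_mul_distrib]
    exact Finset.prod_congr rfl fun l _ => sin_half_exp _ _
  have hPx : P x ≠ 0 := by
    refine Finset.prod_ne_zero_iff.2 fun k _ => Finset.prod_ne_zero_iff.2 fun l hl => ?_
    exact hx _ _ (Finset.mem_Iio.1 hl).ne'
  have hM : Matrix.projVandermonde (V x) (W x) =
      N.transpose * Matrix.projVandermonde (V z) (W z) := by
    ext k p
    rw [Matrix.mul_apply, Matrix.projVandermonde_apply,
      lagrange_homog (V z) (W z) (fun i => Complex.exp_ne_zero _) (fun i j hij => ?_) _ _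
        (Complex.exp_ne_zero _) p]
    · refine Finset.sum_congr rfl fun i _ => ?_
      rw [Matrix.projVandermonde_apply, Matrix.transpose_apply]
      congr 1
      refine Finset.prod_congr rfl fun j _ => ?_
      rw [sin_half_exp, sin_half_exp, mul_div_mul_right _ _ hc]
    · have := hz i j hij
      rw [sin_half_exp] at this
      exact left_ne_zero_of_mul this
  have hdet : P x = N.det * P z := by
    rw [hP, hP, hM, Matrix.det_mul, Matrix.det_transpose, mul_assoc]
  have hterm : ∀ σ : Equiv.Perm (Fin r), (∏ k : Fin r,
        ((∏ j ∈ Finset.univ.erase (σ k),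
            Complex.sin ((x k - z j) / (2 * Complex.I)) /
              Complex.sin ((z (σ k) - z j) / (2 * Complex.I))) *
          ∏ l ∈ Finset.Iio k,
            Complex.sin ((z (σ k) - z (σ l)) / (2 * Complex.I)) /
              Complex.sin ((x k - x l) / (2 * Complex.I)))) =
      ((Equiv.Perm.sign σ : ℤ) : ℂ) * (∏ k, N (σ k) k) * (P z / P x) := by
    intro σ
    have hs := σ.prod_Iio_comp_eq_sign_mul_prod
      (f := fun l k => Complex.sin ((z k - z l) / (2 * Complex.I))) (fun i j => by
        rw [← Complex.sin_neg]; congr 1; ring)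
    rw [Finset.prod_mul_distrib]
    simp only [Finset.prod_div_distrib] at hs ⊢
    rw [hs]
    simp only [N, P, Matrix.of_apply, Finset.prod_div_distrib]
    ring
  rw [Finset.sum_congr rfl fun σ _ => hterm σ, ← Finset.sum_mul, ← Matrix.det_apply',
    ← mul_div_assoc, ← hdet, div_self hPx]
end

section
/- Let 1 ≤ r < n, let x_1,…,x_n and z_1,…,z_n be complex numbers, and let δ⁻, δ⁺ : {1,…,r} → {1,…,n} be injective functions. Assume sin((z_{δ⁻(i)} − z_j)/(2i)) ≠ 0 for every i ∈ {1,…,r} and every j ∈ {1,…,n} with j ≠ δ⁻(i), and sin((x_{δ⁺(i)} − x_{δ⁺(k)})/(2i)) ≠ 0 for all i ≠ k in {1,…,r}. Then ∑_{σ ∈ S_r} [ ∏_{i=1}^r e^{(n−r)(x_{δ⁺(i)} − z_{δ⁻(σ(i))})/2} · ( ∏_{j ∈ {1,…,n}, j ≠ δ⁻(σ(i))} sin((x_{δ⁺(i)} − z_j)/(2i)) / sin((z_{δ⁻(σ(i))} − z_j)/(2i)) ) · ∏_{i<k≤r} sin((z_{δ⁻(σ(i))} − z_{δ⁻(σ(k))})/(2i))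 / sin((x_{δ⁺(i)} − x_{δ⁺(k)})/(2i)) ] = ∏_{i=1}^r e^{(n−r)(x_{δ⁺(i)} − z_{δ⁻(i)})/2} ∏_{j ∉ image(δ⁻)} sin((x_{δ⁺(i)} − z_j)/(2i)) / sin((z_{δ⁻(i)} − z_j)/(2i)). -/
noncomputable section Aux
open Finset

def SS (t : ℂ) : ℂ := Complex.sin (t / (2 * Complex.I))

lemma SS_eq (a b : ℂ) : SS (a - b) = Complex.I / 2 *
    (Complex.exp (b / 2) * Complex.exp (-a / 2) - Complex.exp (a / 2) * Complex.exp (-b / 2)) := by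
  unfold SS
  rw [Complex.sin, ← Complex.exp_add, ← Complex.exp_add]
  have h1 : -((a - b) / (2 * Complex.I)) * Complex.I = b / 2 + -a / 2 := by
    field_simp; ring
  have h2 : ((a - b) / (2 * Complex.I)) * Complex.I = a / 2 + -b / 2 := by
    field_simp; ring
  rw [h1, h2]; ring

lemma SS_eq' (a b : ℂ) : SS (a - b) = -(Complex.I / 2) * Complex.exp (-a / 2) *
    Complex.exp (-b / 2) * (Complex.exp a - Complex.exp b) := by
  rw [SS_eq]
  have h1 : Complex.exp (a / 2) = Complex.exp (-a / 2) * Complex.exp a := by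
    rw [← Complex.exp_add]; congr 1; ring
  have h2 : Complex.exp (b / 2) = Complex.exp (-b / 2) * Complex.exp b := by
    rw [← Complex.exp_add]; congr 1; ring
  rw [h1, h2]; ring

def PV {r : ℕ} (Y : Fin r → ℂ) : Matrix (Fin r) (Fin r) ℂ :=
  Matrix.projVandermonde (fun i => Complex.exp (Y i / 2)) (fun i => Complex.exp (-Y i / 2))

def DD {r : ℕ} (Y : Fin r → ℂ) : ℂ := ∏ k : Fin r, ∏ i ∈ Iio k, SS (Y i - Y k)

lemma DD_eq {r : ℕ} (Y : Fin r → ℂ) :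
    DD Y = (∏ k : Fin r, ∏ _i ∈ Iio k, (Complex.I / 2)) * (PV Y).det := by
  unfold DD PV
  rw [Matrix.det_projVandermonde]
  have : ∏ i : Fin r, ∏ j ∈ Ioi i, (Complex.exp (Y j / 2) * Complex.exp (-Y i / 2)
        - Complex.exp (Y i / 2) * Complex.exp (-Y j / 2)) =
      ∏ j : Fin r, ∏ i ∈ Iio j, (Complex.exp (Y j / 2) * Complex.exp (-Y i / 2)
        - Complex.exp (Y i / 2) * Complex.exp (-Y j / 2)) := by
    apply Finset.prod_comm'
    simp
  rw [this]
  simp only [← Finset.prod_mul_distrib, SS_eq]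

lemma DD_perm {r : ℕ} (Y : Fin r → ℂ) (σ : Equiv.Perm (Fin r)) :
    DD (fun i => Y (σ i)) = (Equiv.Perm.sign σ : ℤ) * DD Y := by
  rw [DD_eq, DD_eq]
  have : PV (fun i => Y (σ i)) = (PV Y).submatrix σ id := by
    ext i j; simp [PV, Matrix.projVandermonde_apply]
  rw [this, Matrix.det_permute]; ring

def TT {r : ℕ} (Y A : Fin r → ℂ) : Matrix (Fin r) (Fin r) ℂ :=
  Matrix.of fun i j => ∏ l ∈ univ.erase j, SS (Y i - A l) / SS (A j - A l)

lemma lag {r : ℕ} (U : Fin r → ℂ) (hU : Function.Injective U) (u : ℂ) (k : Fin r) :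
    ∑ j, (∏ l ∈ univ.erase j, (u - U l) / (U j - U l)) * U j ^ (k : ℕ) = u ^ (k : ℕ) := by
  have h := Lagrange.eq_interpolate (s := univ) (v := U) (f := (Polynomial.X : Polynomial ℂ) ^ (k : ℕ))
    hU.injOn (by simp)
  have h2 := congrArg (Polynomial.eval u) h
  simp only [Lagrange.interpolate_apply, Polynomial.eval_finsetSum, Polynomial.eval_mul,
    Polynomial.eval_C, Polynomial.eval_pow, Polynomial.eval_X, Lagrange.basis, 
    Polynomial.eval_prod, Lagrange.basisDivisor, Polynomial.eval_sub] at h2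
  rw [h2]
  refine Finset.sum_congr rfl fun j _ => ?_
  rw [mul_comm]
  congr 1
  refine Finset.prod_congr rfl fun l _ => ?_
  rw [div_eq_inv_mul]

lemma PV_apply {r : ℕ} (Y : Fin r → ℂ) (i k : Fin r) :
    PV Y i k = Complex.exp (-Y i / 2) ^ (r - 1) * Complex.exp (Y i) ^ (k : ℕ) := by
  have h1 : Complex.exp (Y i / 2) = Complex.exp (-Y i / 2) * Complex.exp (Y i) := by
    rw [← Complex.exp_add]; congr 1; ring
  have h2 : r - 1 = k + (k.rev : ℕ) := by rw [Fin.val_rev]; omega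
  rw [PV, Matrix.projVandermonde_apply, h1, h2, mul_pow, pow_add]; ring

lemma TT_mul {r : ℕ} (Y A : Fin r → ℂ) (hA : ∀ i j, j ≠ i → SS (A i - A j) ≠ 0) :
    TT Y A * PV A = PV Y := by
  have hinj : Function.Injective fun i => Complex.exp (A i) := by
    intro i j hij
    by_contra hne
    apply hA i j (Ne.symm hne)
    have hij' : Complex.exp (A i) = Complex.exp (A j) := hij
    rw [SS_eq', hij']; ring
  ext i k
  rw [Matrix.mul_apply, PV_apply Y, ← lag _ hinj (Complex.exp (Y i)) k, Finset.mul_sum]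
  refine Finset.sum_congr rfl fun j _ => ?_
  rw [PV_apply]
  have : TT Y A i j * Complex.exp (-A j / 2) ^ (r - 1) = Complex.exp (-Y i / 2) ^ (r - 1) *
      ∏ l ∈ univ.erase j, (Complex.exp (Y i) - Complex.exp (A l)) /
        (Complex.exp (A j) - Complex.exp (A l)) := by
    have hc : r - 1 = #(univ.erase j) := by simp
    rw [hc, ← Finset.prod_const, ← Finset.prod_const, TT, Matrix.of_apply,
      ← Finset.prod_mul_distrib, ← Finset.prod_mul_distrib]
    refine Finset.prod_congr rfl fun l hl => ?_
    have hne := hA j l (Finset.ne_of_mem_erase hl)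
    rw [SS_eq'] at hne ⊢
    rw [SS_eq' (A j)]
    have hd : Complex.exp (A j) - Complex.exp (A l) ≠ 0 := right_ne_zero_of_mul hne
    have e1 := Complex.exp_ne_zero (-A j / 2)
    have e2 := Complex.exp_ne_zero (-A l / 2)
    have e3 := Complex.I_ne_zero
    field_simp
  rw [← mul_assoc, this]; ring

lemma main_aux {r : ℕ} (Y A : Fin r → ℂ) (hA : ∀ i j, j ≠ i → SS (A i - A j) ≠ 0)
    (hY : ∀ i k, i ≠ k → SS (Y i - Y k) ≠ 0) :
    ∑ σ : Equiv.Perm (Fin r), (∏ i, ∏ j ∈ univ.erase (σ i), SS (Y i - A j) / SS (A (σ i) - A j)) *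
      ∏ k, ∏ i ∈ Iio k, SS (A (σ i) - A (σ k)) / SS (Y i - Y k) = 1 := by
  have hD : DD Y ≠ 0 := by
    refine Finset.prod_ne_zero_iff.2 fun k _ => Finset.prod_ne_zero_iff.2 fun i hi => ?_
    exact hY i k (Finset.mem_Iio.1 hi).ne
  have hdet : (TT Y A).det * DD A = DD Y := by
    rw [DD_eq, DD_eq, ← TT_mul Y A hA, Matrix.det_mul]; ring
  have hterm : ∀ σ : Equiv.Perm (Fin r),
      (∏ i, ∏ j ∈ univ.erase (σ i), SS (Y i - A j) / SS (A (σ i) - A j)) *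
      ∏ k, ∏ i ∈ Iio k, SS (A (σ i) - A (σ k)) / SS (Y i - Y k) =
      (((Equiv.Perm.sign σ : ℤ) : ℂ) * ∏ i, (TT Y A).transpose (σ i) i) * (DD A / DD Y) := by
    intro σ
    have : ∏ k, ∏ i ∈ Iio k, SS (A (σ i) - A (σ k)) / SS (Y i - Y k) =
        DD (fun i => A (σ i)) / DD Y := by
      simp only [Finset.prod_div_distrib, DD]
    rw [this, DD_perm]
    simp only [TT, Matrix.transpose_apply, Matrix.of_apply]
    ring
  rw [Finset.sum_congr rfl fun σ _ => hterm σ, ← Finset.sum_mul, ← Matrix.det_apply',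
    Matrix.det_transpose, ← mul_div_assoc, hdet, div_self hD]

lemma erase_split {n r : ℕ} (δ : Fin r → Fin n) (hδ : Function.Injective δ) (m : Fin r)
    (f : Fin n → ℂ) : ∏ j ∈ univ.erase (δ m), f j =
      (∏ j ∈ univ \ image δ univ, f j) * ∏ l ∈ univ.erase m, f (δ l) := by
  rw [← Finset.prod_image (s := univ.erase m) (g := δ) (f := f) hδ.injOn, ← Finset.prod_union]
  · apply Finset.prod_congr _ fun _ _ => rfl
    ext j
    simp only [mem_erase, mem_univ, and_true, mem_union, mem_sdiff, mem_image, true_and]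
    constructor
    · intro h
      by_cases hj : ∃ a, δ a = j
      · obtain ⟨a, rfl⟩ := hj
        exact Or.inr ⟨a, fun h' => h (by rw [h']), rfl⟩
      · exact Or.inl hj
    · rintro (h | ⟨a, ha, rfl⟩)
      · exact fun h' => h ⟨m, h'.symm⟩
      · exact fun h' => ha (hδ h')
  · rw [Finset.disjoint_left]
    intro j hj hj'
    simp only [mem_erase, mem_univ, and_true, mem_sdiff, mem_image, true_and] at hj hj'
    obtain ⟨a, _, rfl⟩ := hj'
    exact hj ⟨a, rfl⟩

end Aux


/-- Equation (e:sym2): the sum over the S_r-orbit of the wall-crossing coefficients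
C^H equals the coefficient C_{δ⁻,δ⁺}. -/
theorem stmt_10 (n r : ℕ) (hr : 1 ≤ r) (hrn : r < n) (x z : Fin n → ℂ)
    (δm δp : Fin r → Fin n) (hδm : Function.Injective δm) (hδp : Function.Injective δp)
    (hz : ∀ i : Fin r, ∀ j : Fin n, j ≠ δm i →
      Complex.sin ((z (δm i) - z j) / (2 * Complex.I)) ≠ 0)
    (hx : ∀ i k : Fin r, i ≠ k →
      Complex.sin ((x (δp i) - x (δp k)) / (2 * Complex.I)) ≠ 0) :
    ∑ σ : Equiv.Perm (Fin r),
      ((∏ i : Fin r,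
          Complex.exp (((n : ℂ) - r) * (x (δp i) - z (δm (σ i))) / 2) *
            ∏ j ∈ Finset.univ.erase (δm (σ i)),
              Complex.sin ((x (δp i) - z j) / (2 * Complex.I)) /
                Complex.sin ((z (δm (σ i)) - z j) / (2 * Complex.I))) *
        ∏ k : Fin r, ∏ i ∈ Finset.Iio k,
          Complex.sin ((z (δm (σ i)) - z (δm (σ k))) / (2 * Complex.I)) /
            Complex.sin ((x (δp i) - x (δp k)) / (2 * Complex.I))) =
      ∏ i : Fin r,
        Complex.exp (((n : ℂ) - r) * (x (δp i) - z (δm i)) / 2) *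
          ∏ j ∈ Finset.univ \ Finset.image δm Finset.univ,
            Complex.sin ((x (δp i) - z j) / (2 * Complex.I)) /
              Complex.sin ((z (δm i) - z j) / (2 * Complex.I)) := by

  have hm := main_aux (fun i => x (δp i)) (fun i => z (δm i))
    (fun i j hij => hz i (δm j) (fun h => hij (hδm h))) hx
  simp only [← SS.eq_1] at hz hx ⊢
  have hcommon : ∀ σ : Equiv.Perm (Fin r),
      (∏ i : Fin r, Complex.exp (((n : ℂ) - r) * (x (δp i) - z (δm (σ i))) / 2) *
          ∏ j ∈ Finset.univ \ Finset.image δm Finset.univ,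
            SS (x (δp i) - z j) / SS (z (δm (σ i)) - z j)) =
      (∏ i : Fin r, Complex.exp (((n : ℂ) - r) * (x (δp i) - z (δm i)) / 2) *
          ∏ j ∈ Finset.univ \ Finset.image δm Finset.univ,
            SS (x (δp i) - z j) / SS (z (δm i) - z j)) := by
    intro σ
    have he : ∀ a b : ℂ, Complex.exp (((n : ℂ) - r) * (a - b) / 2) =
        Complex.exp (((n : ℂ) - r) * a / 2) / Complex.exp (((n : ℂ) - r) * b / 2) := by
      intro a b
      rw [← Complex.exp_sub]; congr 1; ring
    simp only [he, Finset.prod_mul_distrib, Finset.prod_div_distrib]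
    rw [Equiv.prod_comp σ (fun i => Complex.exp (((n : ℂ) - r) * z (δm i) / 2)),
      Equiv.prod_comp σ (fun i => ∏ j ∈ Finset.univ \ Finset.image δm Finset.univ,
            SS (z (δm i) - z j))]
  trans ∑ σ : Equiv.Perm (Fin r), (∏ i : Fin r,
        Complex.exp (((n : ℂ) - r) * (x (δp i) - z (δm i)) / 2) *
          ∏ j ∈ Finset.univ \ Finset.image δm Finset.univ,
            SS (x (δp i) - z j) / SS (z (δm i) - z j)) *
        ((∏ i, ∏ j ∈ Finset.univ.erase (σ i),
          SS (x (δp i) - z (δm j)) / SS (z (δm (σ i)) - z (δm j))) *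
        ∏ k, ∏ i ∈ Finset.Iio k,
          SS (z (δm (σ i)) - z (δm (σ k))) / SS (x (δp i) - x (δp k)))
  · refine Finset.sum_congr rfl fun σ _ => ?_
    rw [← hcommon σ, ← mul_assoc]
    congr 1
    rw [← Finset.prod_mul_distrib]
    refine Finset.prod_congr rfl fun i _ => ?_
    rw [erase_split δm hδm, mul_assoc]
  · rw [← Finset.mul_sum, hm, mul_one]
end
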